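/- Let S be a set of primes having natural density d(S), and define the error function E(x) := π_S(x)/π(x) − d(S) for x ≥ 2. If the integral ∫₂^∞ |E(x)| / (x log x) dx converges, then S is a weakly regular set of primes having Dirichlet density δ(S) = d(S). -/

import Mathlib

open Filter Topology

/-- `primeCount S x = #{p ∈ S : p ≤ x}`, the counting function of a set `S ⊆ ℕ`. -/
noncomputable def primeCount (S : Set ℕ) (x : ℝ) : ℕ := {p ∈ S | (p : ℝ) ≤ x}.ncard

/-- The Dirichlet series `∑ p ∈ S, p ^ (-z)`, as an L-series. -/
noncomputable def zetaOn (S : Set ℕ) : ℂ → ℂ := LSeries (S.indicator 1)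

lemma norm_indicator_one_le (S : Set ℕ) (n : ℕ) : ‖S.indicator (1 : ℕ → ℂ) n‖ ≤ 1 := by
  by_cases h : n ∈ S <;> simp [h]

lemma lseriesSummable_indicator (S : Set ℕ) {z : ℂ} (hz : 1 < z.re) :
    LSeriesSummable (S.indicator 1) z :=
  LSeriesSummable_of_bounded_of_one_lt_re (m := 1) (fun n _ ↦ norm_indicator_one_le S n) hz

lemma zetaOn_eq_tsum {S : Set ℕ} (hS : 0 ∉ S) (z : ℂ) :
    zetaOn S z = ∑' p : S, ((p : ℕ) : ℂ) ^ (-z) := by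
  rw [zetaOn, LSeries, tsum_subtype S (fun n : ℕ ↦ (n : ℂ) ^ (-z))]
  refine tsum_congr fun n ↦ ?_
  by_cases hn : n ∈ S
  · have : n ≠ 0 := fun h ↦ hS (h ▸ hn)
    simp [LSeries.term, hn, this, Complex.cpow_neg]
  · simp [LSeries.term, hn]

lemma differentiableOn_zetaOn (S : Set ℕ) :
    DifferentiableOn ℂ (zetaOn S) {z | 1 < z.re} :=
  (LSeries_differentiableOn _).mono fun _ hz ↦
    (LSeries.abscissaOfAbsConv_le_of_le_const
      ⟨1, fun n _ ↦ norm_indicator_one_le S n⟩).trans_lt (mod_cast hz)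

lemma primeCount_eq_sum {S : Set ℕ} (hS : 0 ∉ S) {x : ℝ} (hx : 0 ≤ x) :
    (primeCount S x : ℂ) = ∑ k ∈ Finset.Icc 1 ⌊x⌋₊, S.indicator 1 k := by
  classical
  have : {p ∈ S | (p : ℝ) ≤ x} = ↑{p ∈ Finset.Icc 1 ⌊x⌋₊ | p ∈ S} := by
    ext p
    simp only [Set.mem_ofPred_eq, Finset.coe_filter, Finset.mem_Icc, ← Nat.le_floor_iff hx]
    have : p ∈ S → 1 ≤ p := fun h ↦ Nat.one_le_iff_ne_zero.2 fun h0 ↦ hS (h0 ▸ h)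
    tauto
  rw [primeCount, this, Set.ncard_coe_finset, Finset.card_filter]
  simp [Set.indicator_apply]

lemma primeCount_primes {x : ℝ} (hx : 0 ≤ x) :
    primeCount {p | Nat.Prime p} x = Nat.primeCounting ⌊x⌋₊ := by
  have : {p ∈ {p | Nat.Prime p} | (p : ℝ) ≤ x} = ↑(Nat.primesLE ⌊x⌋₊) := by
    ext p
    simp [← Nat.le_floor_iff hx, Nat.mem_primesLE, and_comm]
  rw [primeCount, this, Set.ncard_coe_finset, Nat.primesLE_card_eq_primeCounting]

lemma primeCount_mono {S T : Set ℕ} (h : S ⊆ T) (x : ℝ) : primeCount S x ≤ primeCount T x := by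
  refine Set.ncard_le_ncard (fun p hp ↦ ⟨h hp.1, hp.2⟩)
    ((Set.finite_Iic ⌊x⌋₊).subset fun p hp ↦ Nat.le_floor hp.2)

lemma primeCounting_floor_le {x : ℝ} (hx : 1 < x) :
    (Nat.primeCounting ⌊x⌋₊ : ℝ) ≤ (2 * Real.log 4 + 2) * (x / Real.log x) := by
  have h := Chebyshev.pi_le_log4_mul_div hx
  have hl := Real.log_pos hx
  have h0 : 0 ≤ x := by linarith
  have h1 : Real.log √x = Real.log x / 2 := Real.log_sqrt h0
  have h2 : √x ≤ 2 * (x / Real.log x) := by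
    have := Real.log_le_sub_one_of_pos (Real.sqrt_pos.2 (by linarith : 0 < x))
    rw [mul_div_assoc', le_div_iff₀ hl]
    nlinarith [Real.sq_sqrt h0, Real.sqrt_nonneg x]
  rw [h1] at h
  have h3 : Real.log 4 * x / (Real.log x / 2) = 2 * Real.log 4 * (x / Real.log x) := by
    field_simp
  linarith

lemma zetaOn_sub_eq_integral {S T : Set ℕ} (hS : 0 ∉ S) (hT : 0 ∉ T) (d : ℝ) {z : ℂ}
    (hz : 1 < z.re) :
    zetaOn S z - d * zetaOn T z =
      z * ∫ t in Set.Ioi (1 : ℝ),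
        ((primeCount S t : ℂ) - d * primeCount T t) * (t : ℂ) ^ (-(z + 1)) := by
  set f : ℕ → ℂ := S.indicator 1 - (d : ℂ) • T.indicator 1 with hf
  have hsum : LSeriesSummable ((d : ℂ) • T.indicator (1 : ℕ → ℂ)) z :=
    (lseriesSummable_indicator T hz).smul _
  have hL : LSeries f z = zetaOn S z - d * zetaOn T z := by
    rw [hf, LSeries_sub (lseriesSummable_indicator S hz) hsum, LSeries_smul]
    rfl
  have hb (n : ℕ) : ‖f n‖ ≤ 1 + |d| := by
    refine (norm_sub_le _ _).trans (add_le_add (norm_indicator_one_le S n) ?_)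
    simpa using mul_le_mul_of_nonneg_left (norm_indicator_one_le T n) (abs_nonneg d)
  rw [← hL, LSeries_eq_mul_integral' f zero_le_one hz]
  · congr 1
    refine MeasureTheory.setIntegral_congr_fun measurableSet_Ioi fun t ht ↦ ?_
    have ht0 : 0 ≤ t := zero_le_one.trans (le_of_lt ht)
    simp only [primeCount_eq_sum hS ht0, primeCount_eq_sum hT ht0, hf, Pi.sub_apply,
      Pi.smul_apply, smul_eq_mul, Finset.sum_sub_distrib, Finset.mul_sum]
  · refine Asymptotics.IsBigO.of_bound (1 + |d|) (Eventually.of_forall fun n ↦ ?_)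
    rw [Real.norm_of_nonneg (Finset.sum_nonneg fun _ _ ↦ norm_nonneg _), Real.rpow_one,
      Real.norm_natCast]
    refine (Finset.sum_le_sum fun k _ ↦ hb k).trans ?_
    simp [mul_add, mul_comm]

lemma measurable_primeCount (S : Set ℕ) : Measurable fun x : ℝ ↦ (primeCount S x : ℝ) := by
  refine Monotone.measurable fun x y hxy ↦ ?_
  refine Nat.cast_le.2 (Set.ncard_le_ncard (fun p hp ↦ ⟨hp.1, hp.2.trans hxy⟩)
    ((Set.finite_Iic ⌊y⌋₊).subset fun p hp ↦ Nat.le_floor hp.2))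

/-- If the relative error of `S` is integrable against `dx / (x log x)`, then
`zetaOn S - d * zetaOn primes` extends continuously to the closed half-plane. -/
lemma exists_continuousOn_zetaOn_sub {S : Set ℕ} (hS : ∀ p ∈ S, Nat.Prime p) {d : ℝ}
    (hE : MeasureTheory.IntegrableOn
      (fun x : ℝ =>
        |(primeCount S x : ℝ) / (primeCount {p | Nat.Prime p} x : ℝ) - d| /
          (x * Real.log x))
      (Set.Ioi 2)) :
    ∃ h : ℂ → ℂ, ContinuousOn h {z : ℂ | 1 ≤ z.re} ∧
      ∀ z : ℂ, 1 < z.re → zetaOn S z - d * zetaOn {p | Nat.Prime p} z = h z := by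
  have hS0 : 0 ∉ S := fun h ↦ Nat.not_prime_zero (hS 0 h)
  have hP0 : 0 ∉ {p | Nat.Prime p} := Nat.not_prime_zero
  let A : ℝ → ℂ := fun t ↦ (primeCount S t : ℂ) - d * primeCount {p | Nat.Prime p} t
  have hAm : Measurable A := by
    have h1 := Complex.measurable_ofReal.comp (measurable_primeCount S)
    have h2 := Complex.measurable_ofReal.comp (measurable_primeCount {p | Nat.Prime p})
    simpa [A, Function.comp_def] using! h1.sub (h2.const_mul (d : ℂ))
  have hAb {t : ℝ} (ht : 2 < t) : ‖A t‖ ≤ (2 * Real.log 4 + 2) *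
      (|(primeCount S t : ℝ) / (primeCount {p | Nat.Prime p} t : ℝ) - d| * (t / Real.log t)) := by
    have hpos : (0 : ℝ) < primeCount {p | Nat.Prime p} t := by
      rw [primeCount_primes (by linarith), Nat.cast_pos]
      exact (by decide : 0 < Nat.primeCounting 2).trans_le
        (Nat.monotone_primeCounting (Nat.le_floor (by exact_mod_cast ht.le)))
    have h1 : A t = (((primeCount S t : ℝ) / (primeCount {p | Nat.Prime p} t : ℝ) - d) *
        primeCount {p | Nat.Prime p} t : ℝ) := by
      rw [sub_mul, div_mul_cancel₀ _ hpos.ne']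
      simp [A]
    rw [h1, Complex.norm_real, norm_mul, Real.norm_eq_abs, Real.norm_of_nonneg hpos.le]
    have hle : (primeCount {p | Nat.Prime p} t : ℝ) ≤
        (2 * Real.log 4 + 2) * (t / Real.log t) := by
      rw [primeCount_primes (by linarith)]
      exact primeCounting_floor_le (by linarith)
    refine (mul_le_mul_of_nonneg_left hle (abs_nonneg _)).trans_eq ?_
    ring
  refine ⟨fun z ↦ z * ∫ t in Set.Ioi (2 : ℝ), A t * (t : ℂ) ^ (-(z + 1)), ?_, fun z hz ↦ ?_⟩
  · refine continuousOn_id.mul (MeasureTheory.continuousOn_of_dominated (fun z _ ↦ ?_)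
      (fun z hz ↦ ?_) (hE.const_mul (2 * Real.log 4 + 2)) ?_)
    · exact (hAm.mul (Complex.measurable_ofReal.pow_const _)).aestronglyMeasurable
    · refine MeasureTheory.ae_restrict_of_forall_mem measurableSet_Ioi fun t (ht : 2 < t) ↦ ?_
      have ht0 : 0 < t := by linarith
      rw [norm_mul, Complex.norm_cpow_eq_rpow_re_of_pos ht0]
      have h2 : t ^ (-(z + 1)).re ≤ t ^ (-2 : ℝ) := by
        refine Real.rpow_le_rpow_of_exponent_le (by linarith) ?_
        simp only [Set.mem_ofPred_eq] at hz
        simp; linarith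
      have hl := Real.log_pos (by linarith : 1 < t)
      calc _ ≤ _ := mul_le_mul (hAb ht) h2 (by positivity) (by positivity)
        _ = _ := by
          rw [Real.rpow_neg ht0.le, Real.rpow_two]
          field_simp
    · refine MeasureTheory.ae_restrict_of_forall_mem measurableSet_Ioi fun t (ht : 2 < t) ↦ ?_
      have ht0 : (t : ℂ) ≠ 0 := by
        have : t ≠ 0 := by linarith
        exact_mod_cast this
      exact continuousOn_const.mul
        (Continuous.const_cpow (by fun_prop) (.inl ht0)).continuousOn
  · rw [zetaOn_sub_eq_integral hS0 hP0 d hz]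
    congr 1
    refine (MeasureTheory.setIntegral_eq_of_subset_of_ae_sdiff_eq_zero
      measurableSet_Ioi.nullMeasurableSet (Set.Ioi_subset_Ioi one_le_two) ?_)
    have hne : ∀ᵐ t : ℝ, t ≠ 2 := MeasureTheory.Measure.ae_ne _ _
    filter_upwards [hne] with t hne ht
    have ht2 : t < 2 := lt_of_le_of_ne (not_lt.1 ht.2) hne
    have ht1 : 1 < t := ht.1
    have h0 : primeCount {p | Nat.Prime p} t = 0 := by
      rw [primeCount_primes (by linarith)]
      have : ⌊t⌋₊ ≤ 1 := Nat.lt_succ_iff.1 ((Nat.floor_lt (by linarith)).2 (by exact_mod_cast ht2))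
      exact Nat.primeCounting_eq_zero_iff.2 this
    have h1 : primeCount S t = 0 := Nat.le_zero.1 (h0 ▸ primeCount_mono hS t)
    simp [h0, h1]

/-- The contribution of the higher prime powers to `log ζ`. -/
noncomputable def primePowerTail (z : ℂ) : ℂ :=
  ∑' p : Nat.Primes, (-Complex.log (1 - (p : ℂ) ^ (-z)) - (p : ℂ) ^ (-z))

lemma norm_prime_cpow_neg_le (p : Nat.Primes) {z : ℂ} (hz : 1 ≤ z.re) :
    ‖(p : ℂ) ^ (-z)‖ ≤ (p : ℝ)⁻¹ := by
  rw [Complex.norm_natCast_cpow_of_pos p.2.pos, ← Real.rpow_neg_one]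
  exact Real.rpow_le_rpow_of_exponent_le (mod_cast p.2.one_le) (by simpa)

lemma inv_prime_le_half (p : Nat.Primes) : (p : ℝ)⁻¹ ≤ 1 / 2 := by
  rw [one_div]
  exact inv_anti₀ two_pos (mod_cast p.2.two_le)

lemma norm_primePowerTail_term_le (p : Nat.Primes) {z : ℂ} (hz : 1 ≤ z.re) :
    ‖-Complex.log (1 - (p : ℂ) ^ (-z)) - (p : ℂ) ^ (-z)‖ ≤ (p : ℝ) ^ (-2 : ℝ) := by
  set w := (p : ℂ) ^ (-z)
  have h1 : ‖w‖ ≤ (p : ℝ)⁻¹ := norm_prime_cpow_neg_le p hz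
  have h2 := h1.trans (inv_prime_le_half p)
  have h3 := Complex.norm_log_one_add_sub_self_le (z := -w) (by rw [norm_neg]; linarith)
  rw [norm_neg, ← sub_eq_add_neg, ← norm_neg] at h3
  have h4 : (1 - ‖w‖)⁻¹ ≤ 2 := by
    rw [inv_le_comm₀ (by linarith) two_pos]
    linarith
  calc _ = _ := by congr 1; ring
    _ ≤ _ := h3
    _ ≤ ‖w‖ ^ 2 * 2 / 2 := by gcongr
    _ = ‖w‖ ^ 2 := by ring
    _ ≤ ((p : ℝ)⁻¹) ^ 2 := by gcongr
    _ = _ := by rw [Real.rpow_neg (Nat.cast_nonneg _), Real.rpow_two, inv_pow]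

lemma summable_prime_rpow_neg_two : Summable fun p : Nat.Primes ↦ (p : ℝ) ^ (-2 : ℝ) :=
  Nat.Primes.summable_rpow.2 (by norm_num)

lemma differentiableAt_primePowerTail_term (p : Nat.Primes) {z : ℂ} (hz : 1 ≤ z.re) :
    DifferentiableAt ℂ
      (fun z ↦ -Complex.log (1 - (p : ℂ) ^ (-z)) - (p : ℂ) ^ (-z)) z := by
  have hp : (p : ℂ) ≠ 0 := mod_cast p.2.ne_zero
  have h : DifferentiableAt ℂ (fun z ↦ (p : ℂ) ^ (-z)) z :=
    differentiableAt_id.neg.const_cpow (.inl hp)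
  refine ((h.const_sub 1).clog ?_).neg.sub h
  rw [sub_eq_add_neg]
  refine Complex.mem_slitPlane_of_norm_lt_one ?_
  rw [norm_neg]
  linarith [norm_prime_cpow_neg_le p hz, inv_prime_le_half p]

lemma continuousOn_primePowerTail : ContinuousOn primePowerTail {z | 1 ≤ z.re} :=
  continuousOn_tsum
    (fun p _ hz ↦ (differentiableAt_primePowerTail_term p hz).continuousAt.continuousWithinAt)
    summable_prime_rpow_neg_two fun p _ hz ↦ norm_primePowerTail_term_le p hz

lemma isOpen_one_lt_re : IsOpen {z : ℂ | 1 < z.re} :=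
  isOpen_lt continuous_const Complex.continuous_re

lemma differentiableOn_primePowerTail : DifferentiableOn ℂ primePowerTail {z | 1 < z.re} :=
  Complex.differentiableOn_tsum_of_summable_norm summable_prime_rpow_neg_two
    (fun p _ hz ↦ (differentiableAt_primePowerTail_term p (le_of_lt hz)).differentiableWithinAt)
    isOpen_one_lt_re fun p _ hz ↦ norm_primePowerTail_term_le p (le_of_lt hz)

lemma exp_zetaOn_primes_add_primePowerTail {z : ℂ} (hz : 1 < z.re) :
    Complex.exp (zetaOn {p | Nat.Prime p} z + primePowerTail z) = riemannZeta z := by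
  rw [← riemannZeta_eulerProduct_exp_log hz, zetaOn_eq_tsum (S := {p | Nat.Prime p}) Nat.not_prime_zero,
    primePowerTail]
  have h1 : Summable fun p : Nat.Primes ↦ (p : ℂ) ^ (-z) := by
    refine Summable.of_norm ?_
    simp_rw [fun p : Nat.Primes ↦ Complex.norm_natCast_cpow_of_pos p.2.pos (-z)]
    exact Nat.Primes.summable_rpow.2 (by simpa)
  have h2 : Summable fun p : Nat.Primes ↦
      (-Complex.log (1 - (p : ℂ) ^ (-z)) - (p : ℂ) ^ (-z)) :=
    Summable.of_norm_bounded summable_prime_rpow_neg_two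
      fun p ↦ norm_primePowerTail_term_le p hz.le
  congr 1
  exact (h1.tsum_add h2).symm.trans (tsum_congr fun p ↦ by ring)

/-- The entire function `(z - 1) * ζ z`. -/
noncomputable def zetaRegularized : ℂ → ℂ := DirichletCharacter.LFunctionTrivChar₁ 1

lemma zetaRegularized_of_ne_one {z : ℂ} (hz : z ≠ 1) :
    zetaRegularized z = (z - 1) * riemannZeta z := by
  rw [zetaRegularized, DirichletCharacter.LFunctionTrivChar₁, Function.update_of_ne hz,
    DirichletCharacter.LFunctionTrivChar, DirichletCharacter.LFunction_modOne_eq]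

lemma differentiable_zetaRegularized : Differentiable ℂ zetaRegularized :=
  DirichletCharacter.differentiable_LFunctionTrivChar₁ 1

lemma zetaRegularized_ne_zero {z : ℂ} (hz : 1 ≤ z.re) : zetaRegularized z ≠ 0 := by
  rcases eq_or_ne z 1 with rfl | h
  · exact DirichletCharacter.LFunctionTrivChar₁_apply_one_ne_zero 1
  · rw [zetaRegularized_of_ne_one h]
    exact mul_ne_zero (sub_ne_zero.2 h) (riemannZeta_ne_zero_of_one_le_re hz)

lemma continuousOn_logDeriv_zetaRegularized :
    ContinuousOn (logDeriv zetaRegularized) {z | 1 ≤ z.re} :=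
  (differentiable_zetaRegularized.contDiff.continuous_deriv le_rfl).continuousOn.div
    differentiable_zetaRegularized.continuous.continuousOn fun _ hz ↦ zetaRegularized_ne_zero hz

lemma sub_one_mem_slitPlane {z : ℂ} (hz : 1 < z.re) : z - 1 ∈ Complex.slitPlane :=
  .inl (by simpa using hz)

/-- The logarithm of `(z - 1) * ζ z` on the open half-plane `1 < re z`. -/
noncomputable def logZetaRegularized (z : ℂ) : ℂ :=
  zetaOn {p | Nat.Prime p} z + primePowerTail z + Complex.log (z - 1)

lemma exp_logZetaRegularized {z : ℂ} (hz : 1 < z.re) :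
    Complex.exp (logZetaRegularized z) = zetaRegularized z := by
  have h1 : z ≠ 1 := by rintro rfl; simp at hz
  rw [logZetaRegularized, Complex.exp_add, exp_zetaOn_primes_add_primePowerTail hz,
    Complex.exp_log (sub_ne_zero.2 h1), zetaRegularized_of_ne_one h1, mul_comm]

lemma hasDerivAt_logZetaRegularized {z : ℂ} (hz : 1 < z.re) :
    HasDerivAt logZetaRegularized (logDeriv zetaRegularized z) z := by
  have hn : {z : ℂ | 1 < z.re} ∈ 𝓝 z := isOpen_one_lt_re.mem_nhds hz
  have hd : DifferentiableAt ℂ logZetaRegularized z :=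
    (((differentiableOn_zetaOn _).differentiableAt hn).add
      (differentiableOn_primePowerTail.differentiableAt hn)).add
      ((differentiableAt_id.sub_const 1).clog (sub_one_mem_slitPlane hz))
  have h1 : HasDerivAt zetaRegularized
      (Complex.exp (logZetaRegularized z) * deriv logZetaRegularized z) z :=
    hd.hasDerivAt.cexp.congr_of_eventuallyEq
      (by filter_upwards [hn] with w hw using (exp_logZetaRegularized hw).symm)
  rw [exp_logZetaRegularized hz] at h1
  rw [logDeriv_apply, h1.deriv, mul_div_cancel_left₀ _ (zetaRegularized_ne_zero hz.le)]
  exact hd.hasDerivAt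

/-- A holomorphic function on `1 < re z` whose derivative extends continuously to `1 ≤ re z`
itself extends continuously to `1 ≤ re z`. -/
lemma exists_continuousOn_extension {f f' : ℂ → ℂ}
    (hf : ∀ z : ℂ, 1 < z.re → HasDerivAt f (f' z) z) (hf' : ContinuousOn f' {z | 1 ≤ z.re}) :
    ∃ h : ℂ → ℂ, ContinuousOn h {z | 1 ≤ z.re} ∧ ∀ z : ℂ, 1 < z.re → f z = h z := by
  let r : ℂ → ℂ := fun z ↦ (max 1 z.re : ℝ) + z.im * Complex.I
  have hre (z : ℂ) : (r z).re = max 1 z.re := by simp [r]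
  have hrc : Continuous r := by fun_prop
  have hr_id {z : ℂ} (hz : 1 < z.re) : r z = z := by
    apply Complex.ext <;> simp [r, hz.le]
  have hc : Continuous (f' ∘ r) :=
    hf'.comp_continuous hrc fun z ↦ by simp [hre]
  refine ⟨fun z ↦ f 2 + ∫ t in (0 : ℝ)..1, (f' ∘ r) (2 + t * (z - 2)) * (z - 2), ?_, ?_⟩
  · refine Continuous.continuousOn (continuous_const.add ?_)
    refine intervalIntegral.continuous_parametric_intervalIntegral_of_continuous' ?_ 0 1
    exact (hc.comp (by fun_prop)).mul (by fun_prop)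
  · intro z hz
    have hline {t : ℝ} (ht : t ∈ Set.uIcc (0 : ℝ) 1) : 1 < (2 + t * (z - 2) : ℂ).re := by
      rw [Set.uIcc_of_le zero_le_one] at ht
      simp only [Complex.add_re, Complex.re_ofNat, Complex.re_ofReal_mul, Complex.sub_re]
      rcases ht.1.eq_or_lt with h | h
      · simp [← h]
      · nlinarith [ht.2, mul_lt_mul_of_pos_left hz h]
    have key := intervalIntegral.integral_eq_sub_of_hasDerivAt
      (f := fun t : ℝ ↦ f (2 + t * (z - 2)))
      (f' := fun t : ℝ ↦ (f' ∘ r) (2 + t * (z - 2)) * (z - 2)) (a := 0) (b := 1)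
      (fun t ht ↦ ?_) (((hc.comp (by fun_prop)).mul continuous_const).intervalIntegrable _ _)
    · simp only at key ⊢
      rw [key]
      simp
    · have hl : HasDerivAt (fun t : ℝ ↦ (2 + t * (z - 2) : ℂ)) (z - 2) t := by
        simpa using ((Complex.ofRealCLM.hasDerivAt (x := t)).mul_const (z - 2)).const_add 2
      simp only [Function.comp_apply, hr_id (hline ht)]
      exact (hf _ (hline ht)).comp t hl

lemma log_one_div_sub_one {z : ℂ} (hz : 1 < z.re) :
    Complex.log (1 / (z - 1)) = -Complex.log (z - 1) := by
  rw [one_div, Complex.log_inv _ (Complex.slitPlane_arg_ne_pi (sub_one_mem_slitPlane hz))]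

/-- The set of all primes is weakly regular. -/
lemma exists_continuousOn_zetaOn_primes :
    ∃ h : ℂ → ℂ, ContinuousOn h {z : ℂ | 1 ≤ z.re} ∧ ∀ z : ℂ, 1 < z.re →
      zetaOn {p | Nat.Prime p} z = Complex.log (1 / (z - 1)) + h z := by
  obtain ⟨h, hc, hh⟩ := exists_continuousOn_extension
    (fun _ ↦ hasDerivAt_logZetaRegularized) continuousOn_logDeriv_zetaRegularized
  refine ⟨fun z ↦ h z - primePowerTail z, hc.sub continuousOn_primePowerTail, fun z hz ↦ ?_⟩
  simp only [← hh z hz, log_one_div_sub_one hz, logZetaRegularized]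
  ring

lemma tendsto_log_one_div_sub_one :
    Tendsto (fun z : ℝ ↦ Real.log (1 / (z - 1))) (𝓝[>] 1) atTop := by
  simp only [one_div]
  refine Real.tendsto_log_atTop.comp (tendsto_inv_nhdsGT_zero.comp ?_)
  refine tendsto_nhdsWithin_iff.2 ⟨?_, ?_⟩
  · refine tendsto_nhdsWithin_of_tendsto_nhds ?_
    simpa using (continuous_sub_right (1 : ℝ)).tendsto 1
  · filter_upwards [self_mem_nhdsWithin] with z hz
    exact sub_pos.2 (Set.mem_Ioi.1 hz)

/-- Let `S` be a set of primes with natural density `d`, and let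
`E(x) := π_S(x)/π(x) − d` be the error function. If `∫₂^∞ |E(x)|/(x log x) dx` converges,
then `S` is weakly regular (with constant `d`) and has Dirichlet density `d`. -/
theorem weaklyRegular_of_integrable_error
    (S : Set ℕ) (hS : ∀ p ∈ S, Nat.Prime p) (d : ℝ)
    (hd : Tendsto
      (fun x : ℝ => (primeCount S x : ℝ) / (primeCount {p | Nat.Prime p} x : ℝ))
      atTop (𝓝 d))
    (hE : MeasureTheory.IntegrableOn
      (fun x : ℝ =>
        |(primeCount S x : ℝ) / (primeCount {p | Nat.Prime p} x : ℝ) - d| /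
          (x * Real.log x))
      (Set.Ioi 2)) :
    (∃ g : ℂ → ℂ, DifferentiableOn ℂ g {z : ℂ | 1 < z.re} ∧
      ContinuousOn g {z : ℂ | 1 ≤ z.re} ∧
      ∀ z : ℂ, 1 < z.re →
        (∑' p : S, ((p : ℕ) : ℂ) ^ (-z)) = (d : ℂ) * Complex.log (1 / (z - 1)) + g z) ∧
    Tendsto (fun z : ℝ => (∑' p : S, ((p : ℕ) : ℝ) ^ (-z)) / Real.log (1 / (z - 1)))
      (𝓝[>] 1) (𝓝 d) := by
  have hS0 : 0 ∉ S := fun h ↦ Nat.not_prime_zero (hS 0 h)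
  obtain ⟨h₁, hc₁, hh₁⟩ := exists_continuousOn_zetaOn_sub hS hE
  obtain ⟨h₂, hc₂, hh₂⟩ := exists_continuousOn_zetaOn_primes
  set g : ℂ → ℂ := fun z ↦ h₁ z + d * h₂ z with hg
  have hgc : ContinuousOn g {z : ℂ | 1 ≤ z.re} := hc₁.add (continuousOn_const.mul hc₂)
  have hgz (z : ℂ) (hz : 1 < z.re) :
      zetaOn S z = (d : ℂ) * Complex.log (1 / (z - 1)) + g z := by
    simp only [hg, ← hh₁ z hz, hh₂ z hz]
    ring
  refine ⟨⟨g, ?_, hgc, fun z hz ↦ zetaOn_eq_tsum hS0 z ▸ hgz z hz⟩, ?_⟩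
  · have hlog : DifferentiableOn ℂ (fun z ↦ zetaOn S z + d * Complex.log (z - 1))
        {z : ℂ | 1 < z.re} :=
      (differentiableOn_zetaOn S).add (((differentiableOn_id.sub_const 1).clog
        fun z hz ↦ sub_one_mem_slitPlane hz).const_mul (d : ℂ))
    refine hlog.congr fun z hz ↦ ?_
    rw [hgz z hz, log_one_div_sub_one hz]
    ring
  · have hmaps : Tendsto (fun z : ℝ ↦ (z : ℂ)) (𝓝[>] 1) (𝓝[{z : ℂ | 1 ≤ z.re}] 1) := by
      refine tendsto_nhdsWithin_iff.2 ⟨?_, ?_⟩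
      · exact tendsto_nhdsWithin_of_tendsto_nhds
          (by simpa using Complex.continuous_ofReal.tendsto 1)
      · filter_upwards [self_mem_nhdsWithin] with z hz
        exact le_of_lt (by simpa using! hz)
    have hgre : Tendsto (fun z : ℝ ↦ (g z).re) (𝓝[>] 1) (𝓝 (g 1).re) :=
      (Complex.continuous_re.tendsto _).comp
        ((hgc.continuousWithinAt (by simp : (1 : ℂ) ∈ _)).tendsto.comp hmaps)
    have hlim := (hgre.div_atTop tendsto_log_one_div_sub_one).const_add d
    rw [add_zero] at hlim
    refine hlim.congr' ?_
    filter_upwards [self_mem_nhdsWithin,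
      tendsto_log_one_div_sub_one.eventually_gt_atTop 0] with z hz hpos
    have hz1 : 1 < (z : ℂ).re := by simpa using! hz
    have hsum : ((∑' p : S, ((p : ℕ) : ℝ) ^ (-z) : ℝ) : ℂ) = zetaOn S z := by
      rw [zetaOn_eq_tsum hS0, Complex.ofReal_tsum]
      refine tsum_congr fun p ↦ ?_
      rw [Complex.ofReal_cpow (Nat.cast_nonneg _)]
      simp
    have hlogz : Complex.log (1 / ((z : ℂ) - 1)) = (Real.log (1 / (z - 1)) : ℝ) := by
      rw [Complex.ofReal_log (one_div_nonneg.2 (sub_nonneg.2 (le_of_lt hz)))]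
      simp
    have hre := congrArg Complex.re (hsum.trans (hgz z hz1))
    rw [hlogz, ← Complex.ofReal_mul, Complex.add_re, Complex.ofReal_re, Complex.ofReal_re] at hre
    rw [hre, add_div, mul_div_cancel_right₀ _ hpos.ne']
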